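/- Let n ≥ 2 and 1 ≤ m < n, and let ρ_X and ρ_Y be rearrangement-invariant function norms on (0,∞) with associate norms ρ_X' and ρ_Y'. Then sup{ρ_Y(t ↦ ∫_t^∞ f(s) s^{m/n−1} ds) : f ≥ 0 measurable, ρ_X(f) ≤ 1} = sup{ρ_X'(s ↦ s^{m/n} g^{**}(s)) : g ≥ 0 measurable, ρ_Y'(g) ≤ 1}. In particular, for any C > 0, the inequality ρ_Y(t ↦ ∫_t^∞ f(s) s^{m/n−1} ds) ≤ C ρ_X(f) holds for all nonnegative measurable f on (0,∞) if and only if the inequality ρ_X'(t ↦ t^{m/n} g^{**}(t)) ≤ C ρ_Y'(g) holds for all nonnegative measurable g on (0,∞), with the same constant C. -/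

import Mathlib

open MeasureTheory Set Filter
open scoped ENNReal NNReal Topology

noncomputable section

/-- Lebesgue measure restricted to `(0,∞)`. -/
def mu0 : Measure ℝ := volume.restrict (Set.Ioi (0:ℝ))

/-- Decreasing rearrangement of an `ℝ≥0∞`-valued function w.r.t. a measure `μ`. -/
def rearrangement {α : Type*} [MeasurableSpace α] (μ : Measure α) (f : α → ℝ≥0∞) (t : ℝ) :
    ℝ≥0∞ :=
  sInf {l : ℝ≥0∞ | μ {x | l < f x} ≤ ENNReal.ofReal t}

/-- Decreasing rearrangement of a (nonnegative) function on `(0,∞)`. -/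
def rearr (f : ℝ → ℝ≥0∞) : ℝ → ℝ≥0∞ := rearrangement mu0 f

/-- The maximal rearrangement `f^{**}(t) = (1/t)∫_0^t f^*(s) ds`. -/
def doubleStar (f : ℝ → ℝ≥0∞) (t : ℝ) : ℝ≥0∞ :=
  (ENNReal.ofReal t)⁻¹ * ∫⁻ s in Set.Ioc (0:ℝ) t, rearr f s

/-- Rearrangement-invariant function norm on `(0,∞)` (axioms (P1)–(P6)). -/
structure IsRINorm (ρ : (ℝ → ℝ≥0∞) → ℝ≥0∞) : Prop where
  eq_zero_iff : ∀ f : ℝ → ℝ≥0∞, Measurable f → (ρ f = 0 ↔ f =ᵐ[mu0] 0)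
  smul : ∀ (c : ℝ≥0) (f : ℝ → ℝ≥0∞), Measurable f →
    ρ (fun t => (c : ℝ≥0∞) * f t) = c * ρ f
  triangle : ∀ f g : ℝ → ℝ≥0∞, Measurable f → Measurable g → ρ (f + g) ≤ ρ f + ρ g
  mono : ∀ f g : ℝ → ℝ≥0∞, Measurable f → Measurable g →
    (∀ᵐ t ∂mu0, f t ≤ g t) → ρ f ≤ ρ g
  fatou : ∀ (F : ℕ → ℝ → ℝ≥0∞) (f : ℝ → ℝ≥0∞), (∀ j, Measurable (F j)) → Measurable f →
    (∀ j t, F j t ≤ F (j + 1) t) → (∀ t, (⨆ j, F j t) = f t) → (⨆ j, ρ (F j)) = ρ f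
  indicator_lt_top : ∀ E : Set ℝ, MeasurableSet E → mu0 E < ∞ → ρ (E.indicator 1) < ∞
  local_L1 : ∀ E : Set ℝ, MeasurableSet E → mu0 E < ∞ → ∃ C : ℝ≥0∞, 0 < C ∧ C < ∞ ∧
    ∀ f : ℝ → ℝ≥0∞, Measurable f → (∫⁻ t in E, f t ∂mu0) ≤ C * ρ f
  rearr_inv : ∀ f g : ℝ → ℝ≥0∞, Measurable f → Measurable g → rearr f = rearr g → ρ f = ρ g

/-- The associate norm `ρ'`. -/
def associate (ρ : (ℝ → ℝ≥0∞) → ℝ≥0∞) (g : ℝ → ℝ≥0∞) : ℝ≥0∞ :=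
  ⨆ (f : ℝ → ℝ≥0∞) (_ : Measurable f) (_ : ρ f ≤ 1), ∫⁻ t, f t * g t ∂mu0

/-- The weighted Hardy-type operator `f ↦ (t ↦ ∫_t^∞ f(s) s^{m/n-1} ds)`. -/
def hardyOp (m n : ℕ) (f : ℝ → ℝ≥0∞) (t : ℝ) : ℝ≥0∞ :=
  ∫⁻ s in Set.Ioi t, f s * ENNReal.ofReal (s ^ ((m : ℝ)/(n : ℝ) - 1))

/-- The function `t ↦ t^{m/n-1} χ_{(1,∞)}(t)`. -/
def tailFun (m n : ℕ) (t : ℝ) : ℝ≥0∞ :=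
  ENNReal.ofReal (t ^ ((m : ℝ)/(n : ℝ) - 1)) * (Set.Ioi (1:ℝ)).indicator 1 t

/-- The functional `σ_m(f) = ρ'(t ↦ t^{m/n} f^{**}(t))`. -/
def sigmaFun (m n : ℕ) (ρ : (ℝ → ℝ≥0∞) → ℝ≥0∞) (f : ℝ → ℝ≥0∞) : ℝ≥0∞ :=
  associate ρ (fun t => ENNReal.ofReal (t ^ ((m : ℝ)/(n : ℝ))) * doubleStar f t)

/-- The optimal-domain functional `τ_m`. -/
def tauFun (m n : ℕ) (ρY : (ℝ → ℝ≥0∞) → ℝ≥0∞) (f : ℝ → ℝ≥0∞) : ℝ≥0∞ :=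
  ⨆ (h : ℝ → ℝ≥0∞) (_ : Measurable h) (_ : rearr h = rearr f), ρY (hardyOp m n h)

/-- The operator `T_α f(t) = t^{-α} sup_{t ≤ s} s^α f^*(s)`. -/
def supOp (α : ℝ) (f : ℝ → ℝ≥0∞) (t : ℝ) : ℝ≥0∞ :=
  ENNReal.ofReal (t ^ (-α)) * ⨆ (s : ℝ) (_ : t ≤ s), ENNReal.ofReal (s ^ α) * rearr f s

/-- `σ` is an optimal (smallest) rearrangement-invariant target norm for `ρX` in the
Hardy-type inequality `‖∫_t^∞ f(s) s^{m/n-1} ds‖_Y ≤ C ‖f‖_X`. -/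
def IsOptimalTargetNorm (m n : ℕ) (ρX σ : (ℝ → ℝ≥0∞) → ℝ≥0∞) : Prop :=
  (∃ C : ℝ≥0∞, 0 < C ∧ C < ∞ ∧
      ∀ f : ℝ → ℝ≥0∞, Measurable f → σ (hardyOp m n f) ≤ C * ρX f) ∧
  ∀ ρZ : (ℝ → ℝ≥0∞) → ℝ≥0∞, IsRINorm ρZ →
    (∃ C : ℝ≥0∞, 0 < C ∧ C < ∞ ∧
       ∀ f : ℝ → ℝ≥0∞, Measurable f → ρZ (hardyOp m n f) ≤ C * ρX f) →
    ∃ c : ℝ≥0∞, 0 < c ∧ c < ∞ ∧ ∀ f : ℝ → ℝ≥0∞, Measurable f → ρZ f ≤ c * σ f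

/-- There exists a rearrangement-invariant target norm for `ρX` in the Hardy-type
inequality. -/
def ExistsRITarget (m n : ℕ) (ρX : (ℝ → ℝ≥0∞) → ℝ≥0∞) : Prop :=
  ∃ (ρY : (ℝ → ℝ≥0∞) → ℝ≥0∞) (C : ℝ≥0∞), IsRINorm ρY ∧ 0 < C ∧ C < ∞ ∧
    ∀ f : ℝ → ℝ≥0∞, Measurable f → ρY (hardyOp m n f) ≤ C * ρX f

/-- There exists a rearrangement-invariant domain norm for `ρY` in the Hardy-type
inequality. -/
def ExistsRIDomain (m n : ℕ) (ρY : (ℝ → ℝ≥0∞) → ℝ≥0∞) : Prop :=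
  ∃ (ρX : (ℝ → ℝ≥0∞) → ℝ≥0∞) (C : ℝ≥0∞), IsRINorm ρX ∧ 0 < C ∧ C < ∞ ∧
    ∀ f : ℝ → ℝ≥0∞, Measurable f → ρY (hardyOp m n f) ≤ C * ρX f

/-- Two functionals are equivalent with constants independent of the function. -/
def EquivNorms (σ τ : (ℝ → ℝ≥0∞) → ℝ≥0∞) : Prop :=
  ∃ c C : ℝ≥0∞, 0 < c ∧ c < ∞ ∧ 0 < C ∧ C < ∞ ∧
    ∀ f : ℝ → ℝ≥0∞, Measurable f → c * σ f ≤ τ f ∧ τ f ≤ C * σ f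

/-- The decay condition defining `V_0^m X(ℝ^n)`: all derivatives of order `< m` have
finite-measure superlevel sets. -/
def DecaysAtInfinity (n m : ℕ) (u : EuclideanSpace ℝ (Fin n) → ℝ) : Prop :=
  ∀ k : ℕ, k < m → ∀ lam : ℝ, 0 < lam →
    volume {x : EuclideanSpace ℝ (Fin n) | lam < ‖iteratedFDeriv ℝ k u x‖} < ∞

/-- Broken logarithm `ℓ^{[a₀,a_∞]}`. -/
def ell (a0 ai : ℝ) (t : ℝ) : ℝ :=
  if t < 1 then (1 - Real.log t) ^ a0 else (1 + Real.log t) ^ ai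

/-- Doubly broken logarithm `ℓℓ^{[b₀,b_∞]}`. -/
def ell2 (b0 bi : ℝ) (t : ℝ) : ℝ :=
  if t < 1 then (1 + Real.log (1 - Real.log t)) ^ b0
  else (1 + Real.log (1 + Real.log t)) ^ bi

/-- Triply broken logarithm `ℓℓℓ^{[c₀,c_∞]}`. -/
def ell3 (c0 ci : ℝ) (t : ℝ) : ℝ :=
  if t < 1 then (1 + Real.log (1 + Real.log (1 - Real.log t))) ^ c0
  else (1 + Real.log (1 + Real.log (1 + Real.log t))) ^ ci

/-- `L^q`-functional (`q ∈ [1,∞]`) of an `ℝ≥0∞`-valued function over `S ⊆ ℝ`. -/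
def Lqnorm (q : ℝ≥0∞) (S : Set ℝ) (g : ℝ → ℝ≥0∞) : ℝ≥0∞ :=
  if q = ∞ then essSup g (volume.restrict S)
  else (∫⁻ t in S, g t ^ q.toReal) ^ (1 / q.toReal)

/-- Lorentz–Zygmund functional `‖f‖_{p,q;[a₀,a_∞]}`, parametrized by `pinv = 1/p`. -/
def LZnorm (pinv : ℝ) (q : ℝ≥0∞) (a0 ai : ℝ) (f : ℝ → ℝ≥0∞) : ℝ≥0∞ :=
  Lqnorm q (Set.Ioi 0)
    (fun t => ENNReal.ofReal (t ^ (pinv - q⁻¹.toReal) * ell a0 ai t) * rearr f t)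

/-- Generalized Lorentz–Zygmund functional with two tiers of logarithms. -/
def GLZnorm2 (pinv : ℝ) (q : ℝ≥0∞) (a0 ai b0 bi : ℝ) (f : ℝ → ℝ≥0∞) : ℝ≥0∞ :=
  Lqnorm q (Set.Ioi 0)
    (fun t => ENNReal.ofReal (t ^ (pinv - q⁻¹.toReal) * ell a0 ai t * ell2 b0 bi t) * rearr f t)

/-- Generalized Lorentz–Zygmund functional with three tiers of logarithms. -/
def GLZnorm3 (pinv : ℝ) (q : ℝ≥0∞) (a0 ai b0 bi c0 ci : ℝ) (f : ℝ → ℝ≥0∞) : ℝ≥0∞ :=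
  Lqnorm q (Set.Ioi 0)
    (fun t => ENNReal.ofReal
      (t ^ (pinv - q⁻¹.toReal) * ell a0 ai t * ell2 b0 bi t * ell3 c0 ci t) * rearr f t)

/-- Young function predicate. -/
structure IsYoung (A : ℝ → ℝ≥0∞) : Prop where
  map_zero : A 0 = 0
  convex : ∀ x y : ℝ, 0 ≤ x → 0 ≤ y → ∀ l : ℝ, 0 ≤ l → l ≤ 1 →
    A (l * x + (1 - l) * y) ≤ ENNReal.ofReal l * A x + ENNReal.ofReal (1 - l) * A y
  left_cont : ∀ x : ℝ, 0 < x → Filter.Tendsto A (nhdsWithin x (Set.Iio x)) (nhds (A x))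
  not_zero : ∃ x : ℝ, 0 < x ∧ A x ≠ 0
  not_top : ∃ x : ℝ, 0 < x ∧ A x ≠ ∞

/-- Canonical extension of a Young function to `ℝ≥0∞`-valued arguments. -/
def eext (A : ℝ → ℝ≥0∞) (x : ℝ≥0∞) : ℝ≥0∞ := if x = ∞ then ∞ else A x.toReal

/-- Luxemburg norm on `(0,∞)`. -/
def luxNorm (A : ℝ → ℝ≥0∞) (f : ℝ → ℝ≥0∞) : ℝ≥0∞ :=
  sInf {l : ℝ≥0∞ | l ≠ 0 ∧ (∫⁻ t in Set.Ioi (0:ℝ), eext A (f t / l)) ≤ 1}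

/-- Generalized (right-continuous) inverse of a nondecreasing `g : ℝ → ℝ≥0∞`. -/
def geninv (g : ℝ → ℝ≥0∞) (y : ℝ≥0∞) : ℝ≥0∞ :=
  ⨅ (s : ℝ) (_ : 0 ≤ s) (_ : y ≤ g s), ENNReal.ofReal s

/-- Young conjugate `Ã(t) = sup_{s ≥ 0} (st - A(s))`. -/
def conjY (A : ℝ → ℝ≥0∞) (t : ℝ) : ℝ≥0∞ :=
  ⨆ (s : ℝ) (_ : 0 ≤ s), (ENNReal.ofReal (s * t) - A s)

/-- `h_A(t) = sup_{0<s<∞} A^{-1}(st)/A^{-1}(s)`. -/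
def hYoung (A : ℝ → ℝ≥0∞) (t : ℝ) : ℝ≥0∞ :=
  ⨆ (s : ℝ) (_ : 0 < s), geninv A (ENNReal.ofReal (s * t)) / geninv A (ENNReal.ofReal s)

/-- The upper Boyd index `I_A = inf_{0<t<1} log t / log h_A(t)`. -/
def upperBoyd (A : ℝ → ℝ≥0∞) : ℝ :=
  sInf ((fun t => Real.log t / Real.log ((hYoung A t).toReal)) '' Set.Ioo (0:ℝ) 1)

/-- `H_m(t) = (∫_0^t (s/A(s))^{m/(n-m)} ds)^{(n-m)/n}`. -/
def Hm (m n : ℕ) (A : ℝ → ℝ≥0∞) (t : ℝ) : ℝ≥0∞ :=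
  (∫⁻ s in Set.Ioc (0:ℝ) t, (ENNReal.ofReal s / A s) ^ ((m : ℝ)/((n : ℝ) - (m : ℝ))))
    ^ (((n : ℝ) - (m : ℝ))/(n : ℝ))

/-- `H^∞ = lim_{t→∞} H_m(t)`. -/
def Hinfty (m n : ℕ) (A : ℝ → ℝ≥0∞) : ℝ≥0∞ := ⨆ t : ℝ, Hm m n A t

/-- `D_m`. -/
def Dm (m n : ℕ) (A : ℝ → ℝ≥0∞) (t : ℝ) : ℝ≥0∞ :=
  if ENNReal.ofReal t < Hinfty m n A then
    (ENNReal.ofReal t * A ((geninv (Hm m n A) (ENNReal.ofReal t)).toReal) /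
        geninv (Hm m n A) (ENNReal.ofReal t)) ^ ((n : ℝ)/((n : ℝ) - (m : ℝ)))
  else ∞

/-- `A_m(t) = ∫_0^t D_m(s)/s ds`. -/
def Am (m n : ℕ) (A : ℝ → ℝ≥0∞) (t : ℝ) : ℝ≥0∞ :=
  ∫⁻ s in Set.Ioc (0:ℝ) t, Dm m n A s / ENNReal.ofReal s

/-- `G_m(t) = t · inf_{0<s≤t} B^{-1}(s) s^{(m-n)/n}`. -/
def Gm (m n : ℕ) (B : ℝ → ℝ≥0∞) (t : ℝ) : ℝ≥0∞ :=
  ENNReal.ofReal t *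
    ⨅ (s : ℝ) (_ : 0 < s) (_ : s ≤ t),
      geninv B (ENNReal.ofReal s) * ENNReal.ofReal (s ^ (((m : ℝ) - (n : ℝ))/(n : ℝ)))

/-- `B_m(t) = ∫_0^t G_m^{-1}(s)/s ds`. -/
def Bm (m n : ℕ) (B : ℝ → ℝ≥0∞) (t : ℝ) : ℝ≥0∞ :=
  ∫⁻ s in Set.Ioc (0:ℝ) t, geninv (Gm m n B) (ENNReal.ofReal s) / ENNReal.ofReal s

/-- `A` dominates `B` near zero. -/
def DomNearZero (A B : ℝ → ℝ≥0∞) : Prop :=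
  ∃ c t0 : ℝ, 0 < c ∧ 0 < t0 ∧ ∀ t : ℝ, 0 ≤ t → t ≤ t0 → B t ≤ A (c * t)

/-- `A` dominates `B` near infinity. -/
def DomNearInfty (A B : ℝ → ℝ≥0∞) : Prop :=
  ∃ c t0 : ℝ, 0 < c ∧ 0 < t0 ∧ ∀ t : ℝ, t0 ≤ t → B t ≤ A (c * t)

def EquivNearZero (A B : ℝ → ℝ≥0∞) : Prop := DomNearZero A B ∧ DomNearZero B A

def EquivNearInfty (A B : ℝ → ℝ≥0∞) : Prop := DomNearInfty A B ∧ DomNearInfty B A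

/-- There exists an Orlicz target for the Hardy-type inequality with domain `L^A`. -/
def ExistsOrliczTarget (m n : ℕ) (A : ℝ → ℝ≥0∞) : Prop :=
  ∃ B : ℝ → ℝ≥0∞, IsYoung B ∧ ∃ C : ℝ≥0∞, 0 < C ∧ C < ∞ ∧
    ∀ f : ℝ → ℝ≥0∞, Measurable f → luxNorm B (hardyOp m n f) ≤ C * luxNorm A f

/-- There exists an Orlicz domain for the Hardy-type inequality with target `L^B`. -/
def ExistsOrliczDomain (m n : ℕ) (B : ℝ → ℝ≥0∞) : Prop :=
  ∃ A : ℝ → ℝ≥0∞, IsYoung A ∧ ∃ C : ℝ≥0∞, 0 < C ∧ C < ∞ ∧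
    ∀ f : ℝ → ℝ≥0∞, Measurable f → luxNorm B (hardyOp m n f) ≤ C * luxNorm A f

/-- `L^{A_m}` is the optimal (smallest) Orlicz target for `L^A`. -/
def IsOptimalOrliczTarget (m n : ℕ) (A B : ℝ → ℝ≥0∞) : Prop :=
  (∃ C : ℝ≥0∞, 0 < C ∧ C < ∞ ∧
      ∀ f : ℝ → ℝ≥0∞, Measurable f → luxNorm B (hardyOp m n f) ≤ C * luxNorm A f) ∧
  ∀ B' : ℝ → ℝ≥0∞, IsYoung B' →
    (∃ C : ℝ≥0∞, 0 < C ∧ C < ∞ ∧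
       ∀ f : ℝ → ℝ≥0∞, Measurable f → luxNorm B' (hardyOp m n f) ≤ C * luxNorm A f) →
    ∃ c : ℝ≥0∞, 0 < c ∧ c < ∞ ∧
      ∀ g : ℝ → ℝ≥0∞, Measurable g → luxNorm B' g ≤ c * luxNorm B g

/-- Model Young-function behaviour `t^p (1 - log t)^a` (near zero). -/
def modelZero (p a : ℝ) (t : ℝ) : ℝ≥0∞ := ENNReal.ofReal (t ^ p * (1 - Real.log t) ^ a)

/-- Model Young-function behaviour `t^p (1 + log t)^a` (near infinity). -/
def modelInf (p a : ℝ) (t : ℝ) : ℝ≥0∞ := ENNReal.ofReal (t ^ p * (1 + Real.log t) ^ a)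



lemma mu0_Iic (a : ℝ) : mu0 (Iic a) = ENNReal.ofReal a := by
  rw [mu0, Measure.restrict_apply measurableSet_Iic, Iic_inter_Ioi, Real.volume_Ioc, sub_zero]

lemma rearr_antitone (g : ℝ → ℝ≥0∞) : Antitone (rearr g) := by
  intro a b hab
  apply sInf_le_sInf
  intro l hl
  exact le_trans hl (ENNReal.ofReal_le_ofReal hab)

lemma rearr_measurable (g : ℝ → ℝ≥0∞) : Measurable (rearr g) :=
  (rearr_antitone g).measurable

lemma le_rearr_of_lt {g : ℝ → ℝ≥0∞} {l : ℝ≥0∞} {t : ℝ}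
    (h : ENNReal.ofReal t < mu0 {x | l < g x}) : l ≤ rearr g t := by
  apply le_sInf
  intro l' hl'
  by_contra hlt
  push Not at hlt
  have : mu0 {x | l < g x} ≤ mu0 {x | l' < g x} :=
    measure_mono (fun x hx => lt_trans hlt hx)
  exact absurd (lt_of_lt_of_le h (this.trans hl')) (lt_irrefl _)

lemma lt_of_lt_rearr {g : ℝ → ℝ≥0∞} {l : ℝ≥0∞} {t : ℝ}
    (h : l < rearr g t) : ENNReal.ofReal t < mu0 {x | l < g x} := by
  by_contra hc
  push Not at hc
  exact absurd (sInf_le (show l ∈ {l : ℝ≥0∞ | mu0 {x | l < g x} ≤ ENNReal.ofReal t} from hc))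
    (not_le.2 h)

lemma vol_layer_lt (y : ℝ≥0∞) : mu0 {l | ENNReal.ofReal l < y} = y := by
  rw [mu0, Measure.restrict_apply (measurableSet_lt (by fun_prop) measurable_const)]
  rcases eq_or_ne y ∞ with rfl | hy
  · have : {l : ℝ | ENNReal.ofReal l < ∞} ∩ Ioi 0 = Ioi 0 := by
      ext l; simp
    rw [this, Real.volume_Ioi]
  · have : {l : ℝ | ENNReal.ofReal l < y} ∩ Ioi 0 = Ioo 0 y.toReal := by
      ext l
      simp only [mem_inter_iff, mem_ofPred_eq, mem_Ioi, mem_Ioo]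
      constructor
      · rintro ⟨h1, h2⟩
        exact ⟨h2, (ENNReal.ofReal_lt_iff_lt_toReal h2.le hy).1 h1⟩
      · rintro ⟨h1, h2⟩
        exact ⟨(ENNReal.ofReal_lt_iff_lt_toReal h1.le hy).2 h2, h1⟩
    rw [this, Real.volume_Ioo, sub_zero, ENNReal.ofReal_toReal hy]

lemma vol_layer_le (y : ℝ≥0∞) : mu0 {l | ENNReal.ofReal l ≤ y} ≤ y := by
  rcases eq_or_ne y ∞ with rfl | hy
  · simp
  · calc mu0 {l | ENNReal.ofReal l ≤ y} ≤ mu0 (Iic y.toReal) := by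
          apply measure_mono
          intro l hl
          exact (ENNReal.ofReal_le_iff_le_toReal hy).1 hl
      _ = y := by rw [mu0_Iic, ENNReal.ofReal_toReal hy]

instance : SFinite mu0 := by unfold mu0; infer_instance
instance : SigmaFinite mu0 := by unfold mu0; infer_instance
instance : IsLocallyFiniteMeasure mu0 := by unfold mu0; infer_instance

lemma restrict_Ioc_le (s : ℝ) : volume.restrict (Ioc 0 s) ≤ mu0 :=
  Measure.restrict_mono (fun _ hx => hx.1) le_rfl

lemma min_le_vol (s : ℝ) (y : ℝ≥0∞) :
    min (ENNReal.ofReal s) y ≤ volume.restrict (Ioc 0 s) {t | ENNReal.ofReal t < y} := by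
  rw [Measure.restrict_apply (measurableSet_lt (by fun_prop) measurable_const)]
  rcases eq_or_ne y ∞ with rfl | hy
  · simp
  · calc min (ENNReal.ofReal s) y = volume (Ioo 0 (min s y.toReal)) := by
          rw [Real.volume_Ioo, sub_zero, ENNReal.ofReal_min, ENNReal.ofReal_toReal hy]
      _ ≤ _ := by
          apply measure_mono
          rintro t ⟨h1, h2⟩
          refine ⟨(ENNReal.ofReal_lt_iff_lt_toReal h1.le hy).2 (h2.trans_le (min_le_right _ _)),
            h1, (h2.trans_le (min_le_left _ _)).le⟩

/-- elementary Hardy-Littlewood on an interval -/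
lemma lintegral_le_rearr (g : ℝ → ℝ≥0∞) (hg : Measurable g) (s : ℝ) :
    ∫⁻ x in Ioc 0 s, g x ≤ ∫⁻ x in Ioc 0 s, rearr g x := by
  have ms1 : MeasurableSet {p : ℝ × ℝ | ENNReal.ofReal p.2 < g p.1} :=
    measurableSet_lt (by fun_prop) (by fun_prop)
  have ms2 : MeasurableSet {p : ℝ × ℝ | ENNReal.ofReal p.2 ≤ rearr g p.1} :=
    measurableSet_le (by fun_prop) ((rearr_measurable g).comp measurable_fst)
  set ν := volume.restrict (Ioc (0:ℝ) s) with hν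
  calc ∫⁻ x, g x ∂ν = ∫⁻ x, mu0 {l | ENNReal.ofReal l < g x} ∂ν := by
        simp only [vol_layer_lt]
    _ = (ν.prod mu0) {p : ℝ × ℝ | ENNReal.ofReal p.2 < g p.1} := by
        rw [Measure.prod_apply ms1]; rfl
    _ = ∫⁻ l, ν {x | ENNReal.ofReal l < g x} ∂mu0 := by
        rw [Measure.prod_apply_symm ms1]; rfl
    _ ≤ ∫⁻ l, ν {x | ENNReal.ofReal l ≤ rearr g x} ∂mu0 := by
        apply lintegral_mono
        intro l
        have h1 : ν {x | ENNReal.ofReal l < g x} ≤ mu0 {x | ENNReal.ofReal l < g x} :=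
          restrict_Ioc_le s _
        have h2 : ν {x | ENNReal.ofReal l < g x} ≤ ENNReal.ofReal s := by
          refine (measure_mono (subset_univ _)).trans ?_
          simp [hν]
        refine (le_min h2 h1).trans ((min_le_vol s _).trans ?_)
        apply measure_mono
        intro t ht
        exact le_rearr_of_lt ht
    _ = (ν.prod mu0) {p : ℝ × ℝ | ENNReal.ofReal p.2 ≤ rearr g p.1} := by
        rw [Measure.prod_apply_symm ms2]; rfl
    _ = ∫⁻ x, mu0 {l | ENNReal.ofReal l ≤ rearr g x} ∂ν := by
        rw [Measure.prod_apply ms2]; rfl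
    _ ≤ ∫⁻ x, rearr g x ∂ν := lintegral_mono fun x => vol_layer_le _

lemma hardyOp_antitone (m n : ℕ) (f : ℝ → ℝ≥0∞) : Antitone (hardyOp m n f) := by
  intro a b hab
  exact lintegral_mono_set (Ioi_subset_Ioi hab)

lemma hardyOp_measurable (m n : ℕ) (f : ℝ → ℝ≥0∞) : Measurable (hardyOp m n f) :=
  (hardyOp_antitone m n f).measurable

/-- Tonelli -/
lemma hardy_tonelli (m n : ℕ) (f k : ℝ → ℝ≥0∞) (hf : Measurable f) (hk : Measurable k) :
    ∫⁻ t, hardyOp m n f t * k t ∂mu0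
      = ∫⁻ s, f s * (ENNReal.ofReal (s ^ ((m : ℝ)/(n : ℝ) - 1)) * ∫⁻ t in Ioc 0 s, k t) ∂mu0 := by
  set φ : ℝ → ℝ≥0∞ := fun s => f s * ENNReal.ofReal (s ^ ((m : ℝ)/(n : ℝ) - 1)) with hφ
  have mφ : Measurable φ := by
    apply hf.mul
    exact (measurable_id.pow_const _).ennreal_ofReal
  have ms : MeasurableSet {p : ℝ × ℝ | p.1 < p.2} := measurableSet_lt measurable_fst measurable_snd
  set K : ℝ → ℝ → ℝ≥0∞ := fun t s =>
    ({p : ℝ × ℝ | p.1 < p.2}).indicator (fun p => φ p.2 * k p.1) (t, s) with hK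
  have mK : Measurable (Function.uncurry K) := by
    have : Function.uncurry K =
      ({p : ℝ × ℝ | p.1 < p.2}).indicator (fun p => φ p.2 * k p.1) := by
      ext ⟨a, b⟩; rfl
    rw [this]
    exact ((mφ.comp measurable_snd).mul (hk.comp measurable_fst)).indicator ms
  calc ∫⁻ t, hardyOp m n f t * k t ∂mu0
      = ∫⁻ t, ∫⁻ s, K t s ∂mu0 ∂mu0 := by
        unfold mu0
        apply setLIntegral_congr_fun measurableSet_Ioi
        intro t ht
        have ht : 0 < t := ht
        change (∫⁻ s in Ioi t, φ s) * k t = _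
        rw [← lintegral_mul_const _ mφ]
        have : ∀ s, K t s = (Ioi t).indicator (fun s => φ s * k t) s := by
          intro s
          simp [hK, indicator_apply]
        simp only [this]
        rw [lintegral_indicator measurableSet_Ioi, Measure.restrict_restrict measurableSet_Ioi,
          Ioi_inter_Ioi, max_eq_left ht.le]
    _ = ∫⁻ s, ∫⁻ t, K t s ∂mu0 ∂mu0 := lintegral_lintegral_swap mK.aemeasurable
    _ = _ := by
        apply lintegral_congr
        intro s
        have : ∀ t, K t s = (Iio s).indicator (fun t => φ s * k t) t := by
          intro t
          simp [hK, indicator_apply]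
        simp only [this]
        rw [lintegral_indicator measurableSet_Iio, mu0, Measure.restrict_restrict measurableSet_Iio,
          lintegral_const_mul _ hk, Iio_inter_Ioi, hφ, mul_assoc,
          restrict_Ioo_eq_restrict_Ioc]

lemma hardy_dual (m n : ℕ) (f g : ℝ → ℝ≥0∞) (hf : Measurable f) :
    ∫⁻ t, hardyOp m n f t * rearr g t ∂mu0
      = ∫⁻ s, f s * (ENNReal.ofReal (s ^ ((m : ℝ)/(n : ℝ))) * doubleStar g s) ∂mu0 := by
  rw [hardy_tonelli m n f _ hf (rearr_measurable g)]
  unfold mu0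
  apply setLIntegral_congr_fun measurableSet_Ioi
  intro s hs
  have hs : 0 < s := hs
  simp only [doubleStar]
  rw [← mul_assoc (ENNReal.ofReal (s ^ ((m : ℝ)/(n : ℝ)))), ← ENNReal.ofReal_inv_of_pos hs,
    ← ENNReal.ofReal_mul (by positivity), Real.rpow_sub_one hs.ne', div_eq_mul_inv]

lemma hardy_HL (m n : ℕ) (f g : ℝ → ℝ≥0∞) (hf : Measurable f) (hg : Measurable g) :
    ∫⁻ t, hardyOp m n f t * g t ∂mu0 ≤ ∫⁻ t, hardyOp m n f t * rearr g t ∂mu0 := by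
  rw [hardy_tonelli m n f _ hf (rearr_measurable g), hardy_tonelli m n f _ hf hg]
  exact lintegral_mono fun s => mul_le_mul' le_rfl
    (mul_le_mul' le_rfl (lintegral_le_rearr g hg s))

lemma dual_measurable (m n : ℕ) (g : ℝ → ℝ≥0∞) :
    Measurable (fun s : ℝ => ENNReal.ofReal (s ^ ((m : ℝ)/(n : ℝ))) * doubleStar g s) := by
  have h : Measurable (fun t : ℝ => ∫⁻ s in Set.Ioc (0:ℝ) t, rearr g s) := by
    apply Monotone.measurable
    intro a b hab
    exact lintegral_mono_set (Ioc_subset_Ioc_right hab)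
  unfold doubleStar
  exact ((measurable_id.pow_const _).ennreal_ofReal).mul
    (ENNReal.measurable_ofReal.inv.mul h)

/-- The rank map of an injective-level function is measure preserving. -/
lemma rank_measurePreserving (G : ℝ → ℝ) (hG : Measurable G) (M : ℝ)
    (hM : ∀ x, 0 < x → G x ≤ M) (hpos : ∀ x, 0 < x → 0 < G x)
    (hfin : ∀ c, 0 < c → mu0 {x | c < G x} ≠ ∞)
    (hnull : ∀ c, mu0 {x | G x = c} = 0) :
    MeasurePreserving (fun x => (mu0 {y | G x < G y}).toReal) mu0 mu0 := by
  set D : ℝ → ℝ≥0∞ := fun c => mu0 {y | c < G y} with hD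
  have Danti : Antitone D := by
    intro a b hab
    exact measure_mono fun y hy => lt_of_le_of_lt hab hy
  have hae : ∀ᵐ x ∂mu0, 0 < x := by
    unfold mu0
    exact ae_restrict_mem measurableSet_Ioi
  have mτ : Measurable (fun x => (D (G x)).toReal) :=
    (Danti.measurable.comp hG).ennreal_toReal
  refine ⟨mτ, ?_⟩
  have DM : D M = 0 := by
    rw [hD]
    change mu0 _ = 0
    rw [measure_eq_zero_iff_ae_notMem]
    filter_upwards [hae] with x hx
    exact not_lt.2 (hM x hx)
  have D0 : D 0 = ∞ := by
    have h1 : D 0 = mu0 univ := by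
      apply measure_congr
      rw [eventuallyEq_set]
      filter_upwards [hae] with x hx
      simp [hpos x hx]
    rw [h1]
    simp [mu0]
  have key : ∀ a, mu0 ((fun x => (D (G x)).toReal) ⁻¹' Iic a) = ENNReal.ofReal a := by
    intro a
    rcases lt_or_ge a 0 with ha | ha
    · have : (fun x => (D (G x)).toReal) ⁻¹' Iic a = ∅ := by
        ext x
        simp only [mem_preimage, mem_Iic, mem_empty_iff_false, iff_false, not_le]
        exact ha.trans_le ENNReal.toReal_nonneg
      rw [this, measure_empty, ENNReal.ofReal_of_nonpos ha.le]
    set A : Set ℝ := {c | 0 ≤ c ∧ D c ≤ ENNReal.ofReal a} with hA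
    have M0 : 0 ≤ M := (hpos 1 one_pos).le.trans (hM 1 one_pos)
    have hne : A.Nonempty := ⟨M, M0, by rw [DM]; exact zero_le⟩
    have hbd : BddBelow A := ⟨0, fun c hc => hc.1⟩
    set c0 := sInf A with hc0
    have c0nn : 0 ≤ c0 := le_csInf hne fun c hc => hc.1
    have hgt : ∀ c, c0 < c → D c ≤ ENNReal.ofReal a := by
      intro c hc
      obtain ⟨c', hc', h⟩ := exists_lt_of_csInf_lt hne hc
      exact (Danti h.le).trans hc'.2
    have hlt : ∀ c, 0 ≤ c → c < c0 → ENNReal.ofReal a < D c := by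
      intro c hc h
      by_contra hcon
      exact absurd (csInf_le hbd (show c ∈ A from ⟨hc, not_lt.1 hcon⟩)) (not_le.2 h)
    -- right-continuity
    have hDc0 : D c0 ≤ ENNReal.ofReal a := by
      have hU : {y | c0 < G y} = ⋃ k : ℕ, {y | c0 + 1 / ((k : ℝ) + 1) < G y} := by
        ext y
        simp only [mem_ofPred_eq, mem_iUnion]
        constructor
        · intro h
          obtain ⟨k, hk⟩ := exists_nat_one_div_lt (sub_pos.2 h)
          exact ⟨k, by linarith⟩
        · rintro ⟨k, hk⟩
          have : (0:ℝ) < 1 / ((k : ℝ) + 1) := by positivity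
          linarith
      have hmono : Monotone fun k : ℕ => {y | c0 + 1 / ((k : ℝ) + 1) < G y} := by
        intro i j hij y hy
        have : (1:ℝ) / ((j : ℝ) + 1) ≤ 1 / ((i : ℝ) + 1) := by
          apply one_div_le_one_div_of_le (by positivity)
          have : (i : ℝ) ≤ j := by exact_mod_cast hij
          linarith
        simp only [mem_ofPred_eq] at hy ⊢
        linarith
      change mu0 {y | c0 < G y} ≤ _
      rw [hU, hmono.measure_iUnion]
      apply iSup_le
      intro k
      apply hgt
      have : (0:ℝ) < 1 / ((k : ℝ) + 1) := by positivity
      linarith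
    have c0pos : 0 < c0 := by
      rcases c0nn.eq_or_lt with h | h
      · rw [← h, D0] at hDc0
        exact absurd hDc0 (by simp)
      · exact h
    have hge : ENNReal.ofReal a ≤ mu0 {y | c0 ≤ G y} := by
      have hI : {y | c0 ≤ G y} = ⋂ k : ℕ, {y | c0 - c0 / ((k : ℝ) + 2) < G y} := by
        ext y
        simp only [mem_ofPred_eq, mem_iInter]
        constructor
        · intro h k
          have : (0:ℝ) < c0 / ((k : ℝ) + 2) := by positivity
          linarith
        · intro h
          by_contra hcon
          push Not at hcon
          obtain ⟨k, hk⟩ := exists_nat_gt (c0 / (c0 - G y))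
          have h1 := h k
          have h2 : 0 < c0 - G y := by linarith
          rw [div_lt_iff₀ h2] at hk
          have h3 : c0 - G y < c0 / ((k : ℝ) + 2) := by linarith
          rw [lt_div_iff₀ (by positivity)] at h3
          nlinarith
      have hanti : Antitone fun k : ℕ => {y | c0 - c0 / ((k : ℝ) + 2) < G y} := by
        intro i j hij y hy
        have : c0 / ((j : ℝ) + 2) ≤ c0 / ((i : ℝ) + 2) := by
          apply div_le_div_of_nonneg_left c0pos.le (by positivity)
          have : (i : ℝ) ≤ j := by exact_mod_cast hij
          linarith
        simp only [mem_ofPred_eq] at hy ⊢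
        linarith
      have hle : ∀ k : ℕ, c0 / ((k : ℝ) + 2) ≤ c0 / 2 := by
        intro k
        apply div_le_div_of_nonneg_left c0pos.le (by positivity)
        have : (0:ℝ) ≤ k := by positivity
        linarith
      rw [hI, hanti.measure_iInter (fun k =>
        (measurableSet_lt measurable_const hG).nullMeasurableSet)
        ⟨0, hfin _ (by have := hle 0; linarith)⟩]
      apply le_iInf
      intro k
      apply le_of_lt
      apply hlt
      · have := hle k; linarith
      · have : (0:ℝ) < c0 / ((k : ℝ) + 2) := by positivity
        linarith
    have heq : mu0 {y | c0 ≤ G y} = D c0 := by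
      apply le_antisymm
      · calc mu0 {y | c0 ≤ G y} ≤ mu0 ({y | c0 < G y} ∪ {y | G y = c0}) := by
              apply measure_mono
              intro y hy
              rcases (show c0 ≤ G y from hy).lt_or_eq with h | h
              · exact Or.inl h
              · exact Or.inr h.symm
          _ ≤ _ := measure_union_le _ _
          _ = D c0 := by rw [hnull, add_zero]
      · exact measure_mono fun y (hy : c0 < G y) => (show c0 ≤ G y from hy.le)
    have hset : mu0 ((fun x => (D (G x)).toReal) ⁻¹' Iic a) = mu0 {y | c0 ≤ G y} := by
      apply measure_congr
      rw [eventuallyEq_set]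
      filter_upwards [hae] with x hx
      simp only [mem_preimage, mem_Iic, mem_ofPred_eq]
      have hf := hfin (G x) (hpos x hx)
      rw [← ENNReal.le_ofReal_iff_toReal_le hf ha]
      constructor
      · intro h
        by_contra hcon
        exact absurd (hlt (G x) (hpos x hx).le (not_le.1 hcon)) (not_lt.2 h)
      · intro h
        exact (Danti h).trans hDc0
    rw [hset]
    exact le_antisymm (heq.le.trans hDc0) hge
  symm
  apply Measure.ext_of_Ioc
  intro a b hab
  have hk : ∀ a, (mu0.map (fun x => (D (G x)).toReal)) (Iic a) = mu0 (Iic a) := by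
    intro a
    rw [Measure.map_apply mτ measurableSet_Iic, key, mu0_Iic]
  have hd : Ioc a b = Iic b \ Iic a := by
    ext x; simp [and_comm]
  rw [hd, measure_sdiff (Iic_subset_Iic.2 hab.le) measurableSet_Iic.nullMeasurableSet
      (by rw [mu0_Iic]; exact ENNReal.ofReal_ne_top),
    measure_sdiff (Iic_subset_Iic.2 hab.le) measurableSet_Iic.nullMeasurableSet
      (by rw [hk, mu0_Iic]; exact ENNReal.ofReal_ne_top), hk, hk]

/-- For a simple function with support of finite measure there is a measure preserving map
along which the rearrangement is dominated by the function. -/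
lemma exists_rank (φ : SimpleFunc ℝ ℝ≥0∞) (hφ : mu0 {x | φ x ≠ 0} ≠ ∞) :
    ∃ τ : ℝ → ℝ, MeasurePreserving τ mu0 mu0 ∧ ∀ᵐ x ∂mu0, rearr φ (τ x) ≤ φ x := by
  classical
  have hae : ∀ᵐ x ∂mu0, 0 < x := by
    unfold mu0
    exact ae_restrict_mem measurableSet_Ioi
  set r : ℝ≥0∞ → ℕ := fun v => (φ.range.filter (· < v)).card with hr
  have rmono : ∀ x y, φ x < φ y → r (φ x) < r (φ y) := by
    intro x y hxy
    apply Finset.card_lt_card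
    rw [Finset.ssubset_iff_of_subset]
    · exact ⟨φ x, by simp [hxy], by simp⟩
    · intro v hv
      simp only [Finset.mem_filter] at hv ⊢
      exact ⟨hv.1, hv.2.trans hxy⟩
  have r0 : r 0 = 0 := by simp [hr]
  set ψ : ℝ → ℝ := fun x => 1 / (1 + x) with hψ
  set G : ℝ → ℝ := fun x => (r (φ x) : ℝ) + ψ x with hGdef
  have mr : Measurable (fun x => (r (φ x) : ℝ)) := (φ.map (fun v => (r v : ℝ))).measurable
  have mG : Measurable G := mr.add (by fun_prop)
  have ψpos : ∀ x, 0 < x → 0 < ψ x := fun x hx => by simp only [hψ]; positivity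
  have ψlt : ∀ x, 0 < x → ψ x < 1 := fun x hx => by
    simp only [hψ]; rw [div_lt_one (by positivity)]; linarith
  have ψinj : ∀ x y, 0 < x → 0 < y → ψ x = ψ y → x = y := fun x y hx hy h => by
    simp only [hψ] at h
    rw [div_eq_div_iff (by positivity) (by positivity)] at h
    linarith
  have Glt : ∀ x y, 0 < x → 0 < y → φ x < φ y → G x < G y := by
    intro x y hx hy h
    have h1 : (r (φ x) : ℝ) + 1 ≤ r (φ y) := by exact_mod_cast rmono x y h
    have h2 := ψpos y hy
    have h3 := ψlt x hx
    simp only [hGdef]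
    linarith
  have Ginj : ∀ x y, 0 < x → 0 < y → G x = G y → x = y := by
    intro x y hx hy h
    rcases lt_trichotomy (φ x) (φ y) with h1 | h1 | h1
    · exact absurd h (Glt x y hx hy h1).ne
    · simp only [hGdef, h1, add_right_inj] at h
      exact ψinj x y hx hy h
    · exact absurd h (Glt y x hy hx h1).ne'
  have hfin : ∀ c, 0 < c → mu0 {x | c < G x} ≠ ∞ := by
    intro c hc
    have hsub : mu0 {x | c < G x} ≤ mu0 ({x | φ x ≠ 0} ∪ Iic (1 / c)) := by
      apply measure_mono_ae
      filter_upwards [hae] with x hx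
      intro h
      have h : c < G x := h
      by_cases h0 : φ x = 0
      · right
        simp only [hGdef, h0, r0, hψ, Nat.cast_zero, zero_add] at h
        rw [lt_div_iff₀ (by positivity)] at h
        change x ≤ 1 / c
        rw [le_div_iff₀ hc]
        nlinarith
      · left; exact h0
    apply ne_top_of_le_ne_top _ (hsub.trans (measure_union_le _ _))
    rw [mu0_Iic]
    exact ENNReal.add_ne_top.2 ⟨hφ, ENNReal.ofReal_ne_top⟩
  have hnull : ∀ c, mu0 {x | G x = c} = 0 := by
    intro c
    unfold mu0
    rw [Measure.restrict_apply (measurableSet_eq_fun mG measurable_const)]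
    apply Set.Subsingleton.measure_zero
    rintro x ⟨hx, hx0⟩ y ⟨hy, hy0⟩
    exact Ginj x y hx0 hy0 ((show G x = c from hx).trans (show G y = c from hy).symm)
  refine ⟨_, rank_measurePreserving G mG (φ.range.card + 1) ?_ ?_ hfin hnull, ?_⟩
  · intro x hx
    have h1 : (r (φ x) : ℝ) ≤ φ.range.card := by exact_mod_cast Finset.card_filter_le _ _
    have h3 := ψlt x hx
    simp only [hGdef]
    linarith
  · intro x hx
    have h2 := ψpos x hx
    have h1 : (0:ℝ) ≤ r (φ x) := by positivity
    simp only [hGdef]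
    linarith
  · filter_upwards [hae] with x hx
    have h2 := ψpos x hx
    have h1 : (0:ℝ) ≤ r (φ x) := by positivity
    apply sInf_le
    change mu0 _ ≤ ENNReal.ofReal _
    rw [ENNReal.ofReal_toReal (hfin _ (by simp only [hGdef]; linarith))]
    apply measure_mono_ae
    filter_upwards [hae] with y hy
    intro h
    exact Glt x y hx hy h

lemma rearr_comp (h : ℝ → ℝ≥0∞) (mh : Measurable h) (τ : ℝ → ℝ)
    (hτ : MeasurePreserving τ mu0 mu0) : rearr (h ∘ τ) = rearr h := by
  funext t
  simp only [rearr, rearrangement]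
  congr 1
  ext l
  simp only [mem_ofPred_eq]
  have : mu0 {x | l < (h ∘ τ) x} = mu0 {x | l < h x} :=
    hτ.measure_preimage (measurableSet_lt measurable_const mh).nullMeasurableSet
  rw [this]

lemma rearr_le_iSup (g : ℝ → ℝ≥0∞) (F : ℕ → ℝ → ℝ≥0∞) (hF : Monotone F)
    (hs : ∀ x, ⨆ k, F k x = g x) (t : ℝ) : rearr g t ≤ ⨆ k, rearr (F k) t := by
  apply le_of_forall_lt
  intro l hl
  obtain ⟨l', hl', hl''⟩ := exists_between hl
  have h1 := lt_of_lt_rearr hl''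
  have hU : {x | l' < g x} = ⋃ k, {x | l' < F k x} := by
    ext x
    simp only [mem_ofPred_eq, mem_iUnion, ← hs x, lt_iSup_iff]
  have hmono : Monotone fun k => {x | l' < F k x} := by
    intro i j hij x hx
    exact lt_of_lt_of_le hx (hF hij x)
  rw [hU, hmono.measure_iUnion, lt_iSup_iff] at h1
  obtain ⟨k, hk⟩ := h1
  exact hl'.trans_le ((le_rearr_of_lt hk).trans (le_iSup (fun k => rearr (F k) t) k))

lemma rearr_mono {f g : ℝ → ℝ≥0∞} (h : f ≤ g) : rearr f ≤ rearr g := by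
  intro t
  apply sInf_le_sInf
  intro l hl
  exact (measure_mono fun x hx => lt_of_lt_of_le hx (h x)).trans hl

/-- Resonance: the key inequality. -/
lemma resonance (h g : ℝ → ℝ≥0∞) (mh : Measurable h) (mg : Measurable g) (B : ℝ≥0∞)
    (hB : ∀ τ : ℝ → ℝ, MeasurePreserving τ mu0 mu0 → ∫⁻ x, h (τ x) * g x ∂mu0 ≤ B) :
    ∫⁻ x, h x * rearr g x ∂mu0 ≤ B := by
  set F : ℕ → SimpleFunc ℝ ℝ≥0∞ := fun k => (SimpleFunc.eapprox g k).restrict (Iio (k : ℝ)) with hF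
  have Fapp : ∀ k x, F k x = (Iio (k : ℝ)).indicator (SimpleFunc.eapprox g k) x := by
    intro k x
    simp only [hF]
    rw [SimpleFunc.restrict_apply _ measurableSet_Iio]
  have Fmono : Monotone fun k => (F k : ℝ → ℝ≥0∞) := by
    intro i j hij x
    change F i x ≤ F j x
    rw [Fapp, Fapp]
    have hij' : (i : ℝ) ≤ j := by exact_mod_cast hij
    refine (indicator_le_indicator_of_subset (Iio_subset_Iio hij') (fun _ => zero_le) x).trans ?_
    exact indicator_le_indicator (SimpleFunc.monotone_eapprox g hij x)
  have Fsup : ∀ x, ⨆ k, F k x = g x := by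
    intro x
    rw [← SimpleFunc.iSup_eapprox_apply mg x]
    apply le_antisymm
    · apply iSup_mono
      intro k
      rw [Fapp]
      exact indicator_le_self _ _ x
    · apply iSup_le
      intro k
      obtain ⟨j, hj⟩ := exists_nat_gt x
      refine le_trans ?_ (le_iSup (fun k => F k x) (max k j))
      simp only [Fapp]
      rw [indicator_of_mem]
      · exact SimpleFunc.monotone_eapprox g (le_max_left k j) x
      · change x < _
        refine hj.trans_le ?_
        exact_mod_cast le_max_right k j
  have Fle : ∀ k x, F k x ≤ g x := fun k x => by
    rw [← Fsup x]; exact le_iSup (fun k => F k x) k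
  calc ∫⁻ x, h x * rearr g x ∂mu0 ≤ ∫⁻ x, ⨆ k, h x * rearr (F k) x ∂mu0 := by
        apply lintegral_mono
        intro x
        dsimp only
        rw [← ENNReal.mul_iSup]
        exact mul_le_mul' le_rfl (rearr_le_iSup g (fun k => F k) Fmono Fsup x)
    _ = ⨆ k, ∫⁻ x, h x * rearr (F k) x ∂mu0 := by
        apply lintegral_iSup
        · intro k
          exact mh.mul (rearr_measurable _)
        · intro i j hij x
          exact mul_le_mul' le_rfl (rearr_mono (Fmono hij) x)
    _ ≤ B := by
        apply iSup_le
        intro k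
        have hfin : mu0 {x | F k x ≠ 0} ≠ ∞ := by
          have : mu0 {x | F k x ≠ 0} ≤ mu0 (Iic (k : ℝ)) := by
            apply measure_mono
            intro x hx
            have hx : F k x ≠ 0 := hx
            rw [Fapp] at hx
            have hx2 : x ∈ Iio (k : ℝ) := Set.mem_of_indicator_ne_zero hx
            exact le_of_lt (mem_Iio.1 hx2)
          rw [mu0_Iic] at this
          exact ne_top_of_le_ne_top ENNReal.ofReal_ne_top this
        obtain ⟨τ, hτ, hle⟩ := exists_rank (F k) hfin
        calc ∫⁻ x, h x * rearr (F k) x ∂mu0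
            = ∫⁻ x, h (τ x) * rearr (F k) (τ x) ∂mu0 :=
              (hτ.lintegral_comp (mh.mul (rearr_measurable _))).symm
          _ ≤ ∫⁻ x, h (τ x) * g x ∂mu0 := by
              apply lintegral_mono_ae
              filter_upwards [hle] with x hx
              exact mul_le_mul' le_rfl (hx.trans (Fle k x))
          _ ≤ B := hB τ hτ

lemma meas_mul {f g : ℝ → ℝ≥0∞} (mf : Measurable f) (mg : Measurable g) :
    Measurable (fun t => f t * g t) := mf.mul mg

namespace IsRINorm

variable {ρ : (ℝ → ℝ≥0∞) → ℝ≥0∞}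

lemma eq_of_ae (hρ : IsRINorm ρ) {f g : ℝ → ℝ≥0∞} (mf : Measurable f) (mg : Measurable g)
    (h : f =ᵐ[mu0] g) : ρ f = ρ g :=
  le_antisymm (hρ.mono f g mf mg h.le) (hρ.mono g f mg mf h.symm.le)

lemma ae_zero_of_associate (hρ : IsRINorm ρ) {w : ℝ → ℝ≥0∞} (mw : Measurable w)
    (h : associate ρ w = 0) : w =ᵐ[mu0] 0 := by
  have hN : ∀ N : ℕ, ∀ᵐ x ∂mu0, x ∈ Iic (N : ℝ) → w x = 0 := by
    intro N
    set e : ℝ → ℝ≥0∞ := (Iic (N : ℝ)).indicator 1 with he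
    have me : Measurable e := measurable_one.indicator measurableSet_Iic
    have hfin : ρ e < ∞ := hρ.indicator_lt_top _ measurableSet_Iic
      (by rw [mu0_Iic]; exact ENNReal.ofReal_lt_top)
    set c : ℝ≥0 := ((ρ e).toNNReal + 1)⁻¹ with hc
    have cpos : 0 < c := by positivity
    have hle : ρ (fun t => (c : ℝ≥0∞) * e t) ≤ 1 := by
      rw [hρ.smul c e me, ← ENNReal.coe_toNNReal hfin.ne, ← ENNReal.coe_mul]
      have : c * (ρ e).toNNReal ≤ 1 := by
        rw [hc, inv_mul_le_iff₀ (by positivity)]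
        simp
      exact_mod_cast this
    have h1 : ∫⁻ t, ((c : ℝ≥0∞) * e t) * w t ∂mu0 ≤ associate ρ w :=
      le_iSup₂_of_le (fun t => (c : ℝ≥0∞) * e t) (me.const_mul _) (le_iSup_of_le hle le_rfl)
    rw [h, nonpos_iff_eq_zero, lintegral_eq_zero_iff (meas_mul (me.const_mul _) mw)] at h1
    filter_upwards [h1] with x hx hxN
    simp only [Pi.zero_apply, mul_eq_zero, ENNReal.coe_eq_zero, cpos.ne', false_or] at hx
    rcases hx with hx | hx
    · simp [he, indicator_of_mem hxN] at hx
    · exact hx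
  filter_upwards [ae_all_iff.2 hN] with x hx
  obtain ⟨N, hN⟩ := exists_nat_gt x
  exact hx N hN.le

lemma holder (hρ : IsRINorm ρ) {f w : ℝ → ℝ≥0∞} (mf : Measurable f) (mw : Measurable w) :
    ∫⁻ t, f t * w t ∂mu0 ≤ ρ f * associate ρ w := by
  by_cases h0 : ρ f = 0
  · have hf := (hρ.eq_zero_iff f mf).1 h0
    have : ∫⁻ t, f t * w t ∂mu0 = 0 := by
      rw [lintegral_eq_zero_iff (meas_mul mf mw)]
      filter_upwards [hf] with x hx
      simp [hx]
    rw [this]; exact zero_le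
  by_cases ht : ρ f = ∞
  · by_cases hw : associate ρ w = 0
    · have hw := hρ.ae_zero_of_associate mw hw
      have : ∫⁻ t, f t * w t ∂mu0 = 0 := by
        rw [lintegral_eq_zero_iff (meas_mul mf mw)]
        filter_upwards [hw] with x hx
        simp [hx]
      rw [this]; exact zero_le
    · rw [ht, ENNReal.top_mul hw]; exact le_top
  set c : ℝ≥0 := (ρ f).toNNReal with hc
  have hcf : (c : ℝ≥0∞) = ρ f := ENNReal.coe_toNNReal ht
  have c0 : c ≠ 0 := by
    intro h
    rw [h] at hcf
    exact h0 hcf.symm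
  have hle : ρ (fun t => ((c⁻¹ : ℝ≥0) : ℝ≥0∞) * f t) ≤ 1 := by
    rw [hρ.smul _ f mf, ← hcf, ← ENNReal.coe_mul, inv_mul_cancel₀ c0]; simp
  have h1 : ∫⁻ t, (((c⁻¹ : ℝ≥0) : ℝ≥0∞) * f t) * w t ∂mu0 ≤ associate ρ w :=
    le_iSup₂_of_le (fun t => ((c⁻¹ : ℝ≥0) : ℝ≥0∞) * f t) (mf.const_mul _)
      (le_iSup_of_le hle le_rfl)
  simp only [mul_assoc] at h1
  rw [lintegral_const_mul _ (meas_mul mf mw)] at h1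
  calc ∫⁻ t, f t * w t ∂mu0 = c * (((c⁻¹ : ℝ≥0) : ℝ≥0∞) * ∫⁻ t, f t * w t ∂mu0) := by
        rw [← mul_assoc, ← ENNReal.coe_mul, mul_inv_cancel₀ c0]; simp
    _ ≤ ρ f * associate ρ w := by
        rw [hcf]; exact mul_le_mul' le_rfl h1

/-- Hölder with the rearrangement. -/
lemma holder_rearr (hρ : IsRINorm ρ) {h g : ℝ → ℝ≥0∞} (mh : Measurable h) (mg : Measurable g) :
    ∫⁻ t, h t * rearr g t ∂mu0 ≤ ρ h * associate ρ g := by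
  apply resonance h g mh mg
  intro τ hτ
  have mhτ : Measurable (h ∘ τ) := mh.comp hτ.measurable
  rw [← hρ.rearr_inv (h ∘ τ) h mhτ mh (rearr_comp h mh τ hτ)]
  exact hρ.holder mhτ mg

end IsRINorm

/-- Truncation. -/
def trunc (k : ℕ) (h : ℝ → ℝ≥0∞) : ℝ → ℝ≥0∞ :=
  (Iio (k : ℝ)).indicator (fun x => min (h x) k)

lemma trunc_measurable (k : ℕ) {h : ℝ → ℝ≥0∞} (mh : Measurable h) : Measurable (trunc k h) :=
  (mh.min measurable_const).indicator measurableSet_Iio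

lemma trunc_le (k : ℕ) (h : ℝ → ℝ≥0∞) (x : ℝ) : trunc k h x ≤ h x :=
  (indicator_le_self _ _ x).trans (min_le_left _ _)

lemma trunc_le_nat (k : ℕ) (h : ℝ → ℝ≥0∞) (x : ℝ) : trunc k h x ≤ k :=
  (indicator_le_self _ _ x).trans (min_le_right _ _)

lemma trunc_ne_top (k : ℕ) (h : ℝ → ℝ≥0∞) (x : ℝ) : trunc k h x ≠ ∞ :=
  ne_top_of_le_ne_top (ENNReal.natCast_ne_top k) (trunc_le_nat k h x)

lemma trunc_mono (h : ℝ → ℝ≥0∞) (x : ℝ) : Monotone (fun k => trunc k h x) := by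
  intro i j hij
  have hij' : (i : ℝ) ≤ j := by exact_mod_cast hij
  have hij'' : (i : ℝ≥0∞) ≤ j := by exact_mod_cast hij
  simp only [trunc]
  refine (indicator_le_indicator_of_subset (Iio_subset_Iio hij') (fun _ => zero_le) x).trans ?_
  exact indicator_le_indicator (min_le_min le_rfl hij'')

lemma iSup_trunc (h : ℝ → ℝ≥0∞) (x : ℝ) : ⨆ k, trunc k h x = h x := by
  apply le_antisymm (iSup_le fun k => trunc_le k h x)
  apply ENNReal.le_of_forall_nnreal_lt
  intro r hr
  obtain ⟨k, hk⟩ := exists_nat_gt (max (r : ℝ) x)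
  refine le_iSup_of_le k ?_
  simp only [trunc]
  rw [indicator_of_mem (show x ∈ Iio (k : ℝ) from (le_max_right _ _).trans_lt hk)]
  apply le_min hr.le
  have : (r : ℝ) ≤ ((k : ℝ≥0) : ℝ) := by
    simpa using ((le_max_left _ _).trans_lt hk).le
  exact_mod_cast this

lemma trunc_memLp (k : ℕ) {h : ℝ → ℝ≥0∞} (mh : Measurable h) :
    MemLp (fun x => (trunc k h x).toReal) 2 mu0 := by
  have hc : MemLp ((Iio (k : ℝ)).indicator (fun _ => (k : ℝ))) 2 mu0 := by
    apply memLp_indicator_const _ measurableSet_Iio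
    right
    have : mu0 (Iio (k:ℝ)) ≤ mu0 (Iic (k:ℝ)) := measure_mono Iio_subset_Iic_self
    rw [mu0_Iic] at this
    exact ne_top_of_le_ne_top ENNReal.ofReal_ne_top this
  refine hc.mono (trunc_measurable k mh).ennreal_toReal.aestronglyMeasurable ?_
  filter_upwards with x
  by_cases hx : x < k
  · rw [indicator_of_mem (show x ∈ Iio (k:ℝ) from hx)]
    rw [Real.norm_of_nonneg ENNReal.toReal_nonneg, Real.norm_of_nonneg (by positivity)]
    exact ENNReal.toReal_le_of_le_ofReal (by positivity) (by simpa using trunc_le_nat k h x)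
  · have : trunc k h x = 0 := by
      simp only [trunc]
      exact indicator_of_notMem (s := Iio (k : ℝ)) hx _
    simp [this]

namespace IsRINorm

variable {ρ : (ℝ → ℝ≥0∞) → ℝ≥0∞}

/-- The (one-sided) unit ball in `L²`. -/
def ball2 (ρ : (ℝ → ℝ≥0∞) → ℝ≥0∞) : Set (Lp ℝ 2 mu0) :=
  {h | ρ (fun x => ENNReal.ofReal (h x)) ≤ 1}

lemma meas_ofReal_Lp (h : Lp ℝ 2 mu0) : Measurable (fun x => ENNReal.ofReal (h x)) :=
  (Lp.stronglyMeasurable h).measurable.ennreal_ofReal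

lemma ball2_convex (hρ : IsRINorm ρ) : Convex ℝ (ball2 ρ) := by
  intro x hx y hy a b ha hb hab
  have hx : ρ (fun t => ENNReal.ofReal (x t)) ≤ 1 := hx
  have hy : ρ (fun t => ENNReal.ofReal (y t)) ≤ 1 := hy
  have mx := meas_ofReal_Lp x
  have my := meas_ofReal_Lp y
  change ρ (fun t => ENNReal.ofReal ((a • x + b • y : Lp ℝ 2 mu0) t)) ≤ 1
  calc ρ (fun t => ENNReal.ofReal ((a • x + b • y : Lp ℝ 2 mu0) t))
      ≤ ρ ((fun t => ((a.toNNReal : ℝ≥0) : ℝ≥0∞) * ENNReal.ofReal (x t))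
          + (fun t => ((b.toNNReal : ℝ≥0) : ℝ≥0∞) * ENNReal.ofReal (y t))) := by
        apply hρ.mono _ _ (meas_ofReal_Lp _) ((mx.const_mul _).add (my.const_mul _))
        filter_upwards [Lp.coeFn_add (a • x) (b • y), Lp.coeFn_smul a x, Lp.coeFn_smul b y]
          with t h1 h2 h3
        rw [h1]
        simp only [Pi.add_apply, h2, h3, Pi.smul_apply, smul_eq_mul]
        refine ENNReal.ofReal_add_le.trans ?_
        rw [ENNReal.ofReal_mul ha, ENNReal.ofReal_mul hb]
        exact le_rfl
    _ ≤ _ := hρ.triangle _ _ (mx.const_mul _) (my.const_mul _)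
    _ = ENNReal.ofReal a * ρ (fun t => ENNReal.ofReal (x t))
        + ENNReal.ofReal b * ρ (fun t => ENNReal.ofReal (y t)) := by
        rw [hρ.smul _ _ mx, hρ.smul _ _ my]; rfl
    _ ≤ ENNReal.ofReal a * 1 + ENNReal.ofReal b * 1 := by gcongr
    _ = 1 := by rw [mul_one, mul_one, ← ENNReal.ofReal_add ha hb, hab, ENNReal.ofReal_one]

lemma ball2_closed (hρ : IsRINorm ρ) : IsClosed (ball2 ρ) := by
  apply IsSeqClosed.isClosed
  intro x y hx hxy
  obtain ⟨ns, -, hns⟩ := (tendstoInMeasure_of_tendsto_Lp hxy).exists_seq_tendsto_ae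
  set X : ℕ → ℝ → ℝ≥0∞ := fun j t => ENNReal.ofReal (x (ns j) t) with hX
  have mX : ∀ j, Measurable (X j) := fun j => meas_ofReal_Lp _
  have hX1 : ∀ j, ρ (X j) ≤ 1 := fun j => hx (ns j)
  set F : ℕ → ℝ → ℝ≥0∞ := fun j t => ⨅ i, X (i + j) t with hF
  have mF : ∀ j, Measurable (F j) := fun j => Measurable.iInf fun i => mX _
  have mL : Measurable (fun t => ⨆ j, F j t) := Measurable.iSup mF
  have hfat := hρ.fatou F (fun t => ⨆ j, F j t) mF mL
    (by
      intro j t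
      apply le_iInf
      intro i
      refine (iInf_le _ (i + 1)).trans (le_of_eq ?_)
      simp only [hX]
      congr 3
      ring_nf) (fun t => rfl)
  change ρ (fun t => ENNReal.ofReal (y t)) ≤ 1
  calc ρ (fun t => ENNReal.ofReal (y t)) ≤ ρ (fun t => ⨆ j, F j t) := by
        apply hρ.mono _ _ (meas_ofReal_Lp y) mL
        filter_upwards [hns] with t ht
        have h2 : Tendsto (fun j => X j t) atTop (𝓝 (ENNReal.ofReal (y t))) :=
          (ENNReal.continuous_ofReal.tendsto _).comp ht
        rw [← h2.liminf_eq, liminf_eq_iSup_iInf_of_nat']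
    _ = ⨆ j, ρ (F j) := hfat.symm
    _ ≤ 1 := by
        apply iSup_le
        intro j
        refine (hρ.mono _ _ (mF j) (mX j) ?_).trans (hX1 j)
        filter_upwards with t
        refine (iInf_le _ 0).trans (le_of_eq ?_)
        simp [hX]

lemma LL_aux (hρ : IsRINorm ρ) {f : ℝ → ℝ≥0∞} (mf : Measurable f) (hf : 1 < ρ f) :
    ∃ g : ℝ → ℝ≥0∞, Measurable g ∧ associate ρ g ≤ 1 ∧ 1 ≤ ∫⁻ t, f t * g t ∂mu0 := by
  have hfat := hρ.fatou (fun k => trunc k f) f (fun k => trunc_measurable k mf) mf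
    (fun j t => trunc_mono f t (Nat.le_succ j)) (iSup_trunc f)
  rw [← hfat, lt_iSup_iff] at hf
  obtain ⟨N, hN⟩ := hf
  set f2 : Lp ℝ 2 mu0 := (trunc_memLp N mf).toLp _ with hf2
  have hf2ae : ∀ᵐ t ∂mu0, f2 t = (trunc N f t).toReal := (trunc_memLp N mf).coeFn_toLp
  have hnot : f2 ∉ ball2 ρ := by
    intro hcon
    have hcon : ρ (fun t => ENNReal.ofReal (f2 t)) ≤ 1 := hcon
    have : ρ (fun t => ENNReal.ofReal (f2 t)) = ρ (trunc N f) := by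
      apply hρ.eq_of_ae (meas_ofReal_Lp f2) (trunc_measurable N mf)
      filter_upwards [hf2ae] with t ht
      rw [ht, ENNReal.ofReal_toReal (trunc_ne_top N f t)]
    rw [this] at hcon
    exact absurd hN (not_lt.2 hcon)
  obtain ⟨L, u, hL, hu⟩ := geometric_hahn_banach_closed_point hρ.ball2_convex hρ.ball2_closed hnot
  have upos : 0 < u := by
    have h0 : (0 : Lp ℝ 2 mu0) ∈ ball2 ρ := by
      change ρ (fun t => ENNReal.ofReal ((0 : Lp ℝ 2 mu0) t)) ≤ 1
      have : ρ (fun t => ENNReal.ofReal ((0 : Lp ℝ 2 mu0) t)) = 0 := by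
        rw [hρ.eq_zero_iff _ (meas_ofReal_Lp _)]
        filter_upwards [Lp.coeFn_zero ℝ 2 mu0] with t ht
        change ENNReal.ofReal _ = 0
        rw [ht]
        simp
      rw [this]; exact zero_le
    simpa using hL 0 h0
  set w : Lp ℝ 2 mu0 := (InnerProductSpace.toDual ℝ (Lp ℝ 2 mu0)).symm L with hw
  have hLw : ∀ a : Lp ℝ 2 mu0, L a = ∫ t, a t * w t ∂mu0 := by
    intro a
    rw [← InnerProductSpace.toDual_symm_apply (𝕜 := ℝ) (y := L), L2.inner_def]
    rfl
  have hIntegr : ∀ a : Lp ℝ 2 mu0, Integrable (fun t => a t * w t) mu0 := by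
    intro a
    exact L2.integrable_inner (𝕜 := ℝ) w a
  have mw : Measurable (w : ℝ → ℝ) := (Lp.stronglyMeasurable w).measurable
  set W : ℝ → ℝ≥0∞ := fun t => ENNReal.ofReal (w t) with hW
  have mW : Measurable W := meas_ofReal_Lp w
  have hlow : ENNReal.ofReal u ≤ ∫⁻ t, f t * W t ∂mu0 := by
    rw [hLw] at hu
    calc ENNReal.ofReal u ≤ ENNReal.ofReal (∫ t, f2 t * w t ∂mu0) :=
          ENNReal.ofReal_le_ofReal hu.le
      _ ≤ ENNReal.ofReal (∫⁻ t, ENNReal.ofReal (f2 t * w t) ∂mu0).toReal := by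
          apply ENNReal.ofReal_le_ofReal
          rw [integral_eq_lintegral_pos_part_sub_lintegral_neg_part (hIntegr f2)]
          linarith [ENNReal.toReal_nonneg
            (a := ∫⁻ t, ENNReal.ofReal (-(f2 t * w t)) ∂mu0)]
      _ ≤ ∫⁻ t, ENNReal.ofReal (f2 t * w t) ∂mu0 := ENNReal.ofReal_toReal_le
      _ ≤ ∫⁻ t, f t * W t ∂mu0 := by
          apply lintegral_mono_ae
          filter_upwards [hf2ae] with t ht
          rw [ht, ENNReal.ofReal_mul ENNReal.toReal_nonneg,
            ENNReal.ofReal_toReal (trunc_ne_top N f t)]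
          exact mul_le_mul' (trunc_le N f t) le_rfl
  have hup : ∀ h : ℝ → ℝ≥0∞, Measurable h → ρ h ≤ 1 → ∫⁻ t, h t * W t ∂mu0 ≤ ENNReal.ofReal u := by
    intro h mh hh
    have hk : ∀ k : ℕ, ∫⁻ t, trunc k h t * W t ∂mu0 ≤ ENNReal.ofReal u := by
      intro k
      have mP : MeasurableSet {t : ℝ | 0 < w t} := measurableSet_lt measurable_const mw
      have hmem : MemLp ({t : ℝ | 0 < w t}.indicator (fun t => (trunc k h t).toReal)) 2 mu0 :=
        (trunc_memLp k mh).indicator mP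
      set a : Lp ℝ 2 mu0 := hmem.toLp _ with ha
      have haae : ∀ᵐ t ∂mu0,
          a t = {t : ℝ | 0 < w t}.indicator (fun t => (trunc k h t).toReal) t :=
        hmem.coeFn_toLp
      have haS : a ∈ ball2 ρ := by
        change ρ (fun t => ENNReal.ofReal (a t)) ≤ 1
        refine (hρ.mono _ h (meas_ofReal_Lp a) mh ?_).trans hh
        filter_upwards [haae] with t ht
        rw [ht]
        refine le_trans (ENNReal.ofReal_le_ofReal
          (indicator_le_self' (fun _ _ => ENNReal.toReal_nonneg) t)) ?_
        rw [ENNReal.ofReal_toReal (trunc_ne_top k h t)]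
        exact trunc_le k h t
      have h1 := (hL a haS).le
      rw [hLw] at h1
      refine le_trans (le_of_eq ?_) (ENNReal.ofReal_le_ofReal h1)
      rw [ofReal_integral_eq_lintegral_ofReal (hIntegr a)]
      · apply lintegral_congr_ae
        filter_upwards [haae] with t ht
        rw [ht]
        by_cases hp : 0 < w t
        · rw [indicator_of_mem (show t ∈ {t : ℝ | 0 < w t} from hp),
            ENNReal.ofReal_mul ENNReal.toReal_nonneg,
            ENNReal.ofReal_toReal (trunc_ne_top k h t)]
        · rw [indicator_of_notMem (show t ∉ {t : ℝ | 0 < w t} from hp)]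
          simp [hW, ENNReal.ofReal_of_nonpos (not_lt.1 hp)]
      · filter_upwards [haae] with t ht
        rw [ht]
        by_cases hp : 0 < w t
        · rw [indicator_of_mem (show t ∈ {t : ℝ | 0 < w t} from hp)]
          exact mul_nonneg ENNReal.toReal_nonneg hp.le
        · rw [indicator_of_notMem (show t ∉ {t : ℝ | 0 < w t} from hp)]
          simp
    have heq : ∫⁻ t, h t * W t ∂mu0 = ⨆ k, ∫⁻ t, trunc k h t * W t ∂mu0 := by
      rw [← lintegral_iSup (fun k => meas_mul (trunc_measurable k mh) mW)]
      · apply lintegral_congr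
        intro t
        rw [← ENNReal.iSup_mul, iSup_trunc]
      · intro i j hij t
        exact mul_le_mul' (trunc_mono h t hij) le_rfl
    rw [heq]
    exact iSup_le hk
  have u0 : ENNReal.ofReal u ≠ 0 := by simpa using upos
  have hc : (ENNReal.ofReal u)⁻¹ * ENNReal.ofReal u = 1 :=
    ENNReal.inv_mul_cancel u0 ENNReal.ofReal_ne_top
  have hpull : ∀ h : ℝ → ℝ≥0∞, Measurable h →
      ∫⁻ t, h t * ((ENNReal.ofReal u)⁻¹ * W t) ∂mu0
        = (ENNReal.ofReal u)⁻¹ * ∫⁻ t, h t * W t ∂mu0 := by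
    intro h mh
    rw [← lintegral_const_mul _ (meas_mul mh mW)]
    apply lintegral_congr
    intro t
    ring
  refine ⟨fun t => (ENNReal.ofReal u)⁻¹ * W t, mW.const_mul _, ?_, ?_⟩
  · refine iSup_le fun h => iSup_le fun mh => iSup_le fun hh => ?_
    rw [hpull h mh, ← hc]
    exact mul_le_mul' le_rfl (hup h mh hh)
  · rw [hpull f mf, ← hc]
    exact mul_le_mul' le_rfl hlow

/-- Lorentz-Luxemburg. -/
lemma LL (hρ : IsRINorm ρ) {f : ℝ → ℝ≥0∞} (mf : Measurable f) (B : ℝ≥0∞)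
    (hB : ∀ g : ℝ → ℝ≥0∞, Measurable g → associate ρ g ≤ 1 → ∫⁻ t, f t * g t ∂mu0 ≤ B) :
    ρ f ≤ B := by
  apply ENNReal.le_of_forall_nnreal_lt
  intro c hc
  rcases eq_or_ne c 0 with rfl | c0
  · simp
  have h1 : 1 < ρ (fun t => ((c⁻¹ : ℝ≥0) : ℝ≥0∞) * f t) := by
    rw [hρ.smul _ f mf]
    have : (1 : ℝ≥0∞) = ((c⁻¹ : ℝ≥0) : ℝ≥0∞) * c := by
      rw [← ENNReal.coe_mul, inv_mul_cancel₀ c0]; simp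
    rw [this]
    exact ENNReal.mul_lt_mul_right (by simpa using c0) ENNReal.coe_ne_top hc
  obtain ⟨g, mg, hg1, hg2⟩ := hρ.LL_aux (mf.const_mul _) h1
  simp only [mul_assoc] at hg2
  rw [lintegral_const_mul _ (meas_mul mf mg)] at hg2
  calc (c : ℝ≥0∞) = c * 1 := (mul_one _).symm
    _ ≤ c * (((c⁻¹ : ℝ≥0) : ℝ≥0∞) * ∫⁻ t, f t * g t ∂mu0) := mul_le_mul' le_rfl hg2
    _ = ∫⁻ t, f t * g t ∂mu0 := by
        rw [← mul_assoc, ← ENNReal.coe_mul, mul_inv_cancel₀ c0]; simp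
    _ ≤ B := hB g mg hg1

end IsRINorm

/-- duality between the Hardy-type inequality and its dual form. -/
theorem statement3 (n m : ℕ) (hn : 2 ≤ n) (hm : 1 ≤ m) (hmn : m < n)
    (ρX ρY : (ℝ → ℝ≥0∞) → ℝ≥0∞) (hX : IsRINorm ρX) (hY : IsRINorm ρY) :
    (⨆ (f : ℝ → ℝ≥0∞) (_ : Measurable f) (_ : ρX f ≤ 1), ρY (hardyOp m n f))
      = (⨆ (g : ℝ → ℝ≥0∞) (_ : Measurable g) (_ : associate ρY g ≤ 1),
          associate ρX (fun s => ENNReal.ofReal (s ^ ((m : ℝ)/(n : ℝ))) * doubleStar g s))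
    ∧
    ∀ C : ℝ≥0∞, 0 < C →
      ((∀ f : ℝ → ℝ≥0∞, Measurable f → ρY (hardyOp m n f) ≤ C * ρX f) ↔
       (∀ g : ℝ → ℝ≥0∞, Measurable g →
          associate ρX (fun t => ENNReal.ofReal (t ^ ((m : ℝ)/(n : ℝ))) * doubleStar g t)
            ≤ C * associate ρY g)) := by
  have hfwd : ∀ f g : ℝ → ℝ≥0∞, Measurable f → Measurable g →
      ∫⁻ s, f s * (ENNReal.ofReal (s ^ ((m : ℝ)/(n : ℝ))) * doubleStar g s) ∂mu0
        ≤ ρY (hardyOp m n f) * associate ρY g := by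
    intro f g mf mg
    rw [← hardy_dual m n f g mf]
    exact hY.holder_rearr (hardyOp_measurable m n f) mg
  have hbwd : ∀ f g : ℝ → ℝ≥0∞, Measurable f → Measurable g →
      ∫⁻ t, hardyOp m n f t * g t ∂mu0 ≤ ρX f *
        associate ρX (fun s => ENNReal.ofReal (s ^ ((m : ℝ)/(n : ℝ))) * doubleStar g s) := by
    intro f g mf mg
    refine (hardy_HL m n f g mf mg).trans ?_
    rw [hardy_dual m n f g mf]
    exact hX.holder mf (dual_measurable m n g)
  refine ⟨le_antisymm ?_ ?_, fun C hC => ⟨?_, ?_⟩⟩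
  · refine iSup_le fun f => iSup_le fun mf => iSup_le fun hf => ?_
    apply hY.LL (hardyOp_measurable m n f)
    intro g mg hg
    refine (hbwd f g mf mg).trans ?_
    refine (mul_le_mul' hf le_rfl).trans ?_
    rw [one_mul]
    exact le_iSup₂_of_le g mg (le_iSup_of_le hg le_rfl)
  · refine iSup_le fun g => iSup_le fun mg => iSup_le fun hg => ?_
    refine iSup_le fun f => iSup_le fun mf => iSup_le fun hf => ?_
    refine (hfwd f g mf mg).trans ((mul_le_mul' le_rfl hg).trans ?_)
    rw [mul_one]
    exact le_iSup₂_of_le f mf (le_iSup_of_le hf le_rfl)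
  · intro h g mg
    refine iSup_le fun f => iSup_le fun mf => iSup_le fun hf => ?_
    refine (hfwd f g mf mg).trans (mul_le_mul' ?_ le_rfl)
    refine (h f mf).trans ?_
    calc C * ρX f ≤ C * 1 := mul_le_mul' le_rfl hf
      _ = C := mul_one C
  · intro h f mf
    apply hY.LL (hardyOp_measurable m n f)
    intro g mg hg
    refine (hbwd f g mf mg).trans ?_
    rw [mul_comm C]
    refine mul_le_mul' le_rfl ((h g mg).trans ?_)
    calc C * associate ρY g ≤ C * 1 := mul_le_mul' le_rfl hg
      _ = C := mul_one C

end
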